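/- For any sample 𝒮ₙ = (X₁, …, Xₙ) of n partitions, the map sending a multiple alignment 𝔛 to the partition π(M_𝔛) represented by its mean restricts to a surjective map from the set of optimal multiple alignments of 𝒮ₙ (global minimizers of fₙ) onto the set of mean partitions of 𝒮ₙ (global minimizers of Fₙ); in particular, for every optimal multiple alignment 𝔛, π(M_𝔛) is a mean partition of 𝒮ₙ, and every mean partition of 𝒮ₙ arises this way. -/

import Mathlib

/-!
Partition spaces for consensus clustering (Jain, "Condorcet's Jury Theorem for
Consensus Clustering").  Labeled partitions are ℓ×m column-stochastic matrices
with entries in [0,1]; the group Π of ℓ×ℓ permutation matrices acts by left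
multiplication; partitions are orbits; δ is induced by the Frobenius norm.
-/

namespace CJT

/-- ℓ×m real matrices. -/
abbrev Mat (l m : ℕ) := Matrix (Fin l) (Fin m) ℝ

/-- `P` is an ℓ×ℓ permutation matrix. -/
def IsPermMatrix {l : ℕ} (P : Matrix (Fin l) (Fin l) ℝ) : Prop :=
  ∃ σ : Equiv.Perm (Fin l), ∀ i k, P i k = if σ i = k then 1 else 0

/-- `X` is a labeled partition: entries in `[0,1]`, columns summing to one. -/
def IsLabeled {l m : ℕ} (X : Mat l m) : Prop :=
  (∀ i j, 0 ≤ X i j ∧ X i j ≤ 1) ∧ ∀ j, (∑ i, X i j) = 1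

/-- The orbit `[X] = {P X : P ∈ Π}` of a labeled partition. -/
def orbit {l m : ℕ} (X : Mat l m) : Set (Mat l m) :=
  {Y | ∃ P : Matrix (Fin l) (Fin l) ℝ, IsPermMatrix P ∧ Y = P * X}

/-- The partition space 𝒫: all orbits of labeled partitions. -/
def PartitionSpace (l m : ℕ) : Set (Set (Mat l m)) :=
  {A | ∃ X : Mat l m, IsLabeled X ∧ A = orbit X}

/-- Frobenius (Euclidean) norm. -/
noncomputable def frobNorm {l m : ℕ} (X : Mat l m) : ℝ :=
  Real.sqrt (∑ i, ∑ j, (X i j) ^ 2)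

/-- `δ(A, B) = min {‖X' − Y'‖ : X' ∈ A, Y' ∈ B}`. -/
noncomputable def pdist {l m : ℕ} (A B : Set (Mat l m)) : ℝ :=
  sInf {d | ∃ X ∈ A, ∃ Y ∈ B, d = frobNorm (X - Y)}

/-- The Fréchet function `Fₙ(Z) = (1/n) Σᵢ δ(Xᵢ, Z)²` of a sample
`𝒮ₙ = (X₁, …, Xₙ)` of `n` partitions. -/
noncomputable def frechet {l m n : ℕ} (s : Fin n → Set (Mat l m)) (A : Set (Mat l m)) : ℝ :=
  (1 / (n : ℝ)) * ∑ i, (pdist (s i) A) ^ 2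

/-- A mean partition of the sample `s`: a global minimizer of the Fréchet
function over the partition space 𝒫. -/
def IsMeanPartition {l m n : ℕ} (s : Fin n → Set (Mat l m)) (M : Set (Mat l m)) : Prop :=
  M ∈ PartitionSpace l m ∧ ∀ W ∈ PartitionSpace l m, frechet s M ≤ frechet s W

/-- A multiple alignment of the sample `s`: a choice of representations
`Xᵢ' ∈ Xᵢ`. -/
def IsAlignment {l m n : ℕ} (s : Fin n → Set (Mat l m)) (R : Fin n → Mat l m) : Prop :=
  ∀ i, R i ∈ s i

/-- `fₙ(𝔛) = (1/n²) Σᵢ Σⱼ ‖Xᵢ' − Xⱼ'‖²`. -/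
noncomputable def alignCost {l m n : ℕ} (R : Fin n → Mat l m) : ℝ :=
  (1 / (n : ℝ) ^ 2) * ∑ i, ∑ j, (frobNorm (R i - R j)) ^ 2

/-- An optimal multiple alignment: a global minimizer of `fₙ` over all multiple
alignments of the sample `s`. -/
def IsOptimalAlignment {l m n : ℕ} (s : Fin n → Set (Mat l m)) (R : Fin n → Mat l m) : Prop :=
  IsAlignment s R ∧ ∀ R' : Fin n → Mat l m, IsAlignment s R' → alignCost R ≤ alignCost R'

/-- The mean `M_𝔛 = (1/n) Σᵢ Xᵢ'` of a multiple alignment. -/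
noncomputable def alignMean {l m n : ℕ} (R : Fin n → Mat l m) : Mat l m :=
  ((n : ℝ)⁻¹) • ∑ i, R i

theorem mem_orbit_iff {l m : ℕ} {X Y : Mat l m} :
    Y ∈ orbit X ↔ ∃ σ : Equiv.Perm (Fin l), Y = X.submatrix σ id := by
  have key : ∀ (P : Matrix (Fin l) (Fin l) ℝ) (σ : Equiv.Perm (Fin l)),
      (∀ i k, P i k = if σ i = k then 1 else 0) → P * X = X.submatrix σ id := by
    intro P σ hP
    ext i j
    simp [Matrix.mul_apply, hP]
  constructor
  · rintro ⟨P, ⟨σ, hσ⟩, rfl⟩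
    exact ⟨σ, key P σ hσ⟩
  · rintro ⟨σ, rfl⟩
    exact ⟨fun i k => if σ i = k then 1 else 0, ⟨σ, fun _ _ => rfl⟩,
      (key _ σ fun _ _ => rfl).symm⟩

theorem self_mem_orbit {l m : ℕ} (X : Mat l m) : X ∈ orbit X :=
  mem_orbit_iff.2 ⟨1, rfl⟩

theorem submatrix_mem_orbit {l m : ℕ} {X Y : Mat l m} (hY : Y ∈ orbit X)
    (σ : Equiv.Perm (Fin l)) : Y.submatrix σ id ∈ orbit X := by
  obtain ⟨τ, rfl⟩ := mem_orbit_iff.1 hY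
  exact mem_orbit_iff.2 ⟨τ * σ, rfl⟩

theorem finite_orbit {l m : ℕ} (X : Mat l m) : (orbit X).Finite := by
  refine (Set.finite_range fun σ : Equiv.Perm (Fin l) => X.submatrix σ id).subset ?_
  intro Y hY
  obtain ⟨σ, rfl⟩ := mem_orbit_iff.1 hY
  exact ⟨σ, rfl⟩

theorem IsLabeled.of_mem_orbit {l m : ℕ} {X Y : Mat l m} (hX : IsLabeled X)
    (hY : Y ∈ orbit X) : IsLabeled Y := by
  obtain ⟨σ, rfl⟩ := mem_orbit_iff.1 hY
  exact ⟨fun i j => hX.1 (σ i) j, fun j => (Equiv.sum_comp σ fun i => X i j).trans (hX.2 j)⟩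

theorem frobNorm_sq {l m : ℕ} (X : Mat l m) : frobNorm X ^ 2 = ∑ i, ∑ j, X i j ^ 2 :=
  Real.sq_sqrt (Finset.sum_nonneg fun _ _ => Finset.sum_nonneg fun _ _ => sq_nonneg _)

theorem frobNorm_nonneg {l m : ℕ} (X : Mat l m) : 0 ≤ frobNorm X :=
  Real.sqrt_nonneg _

theorem frobNorm_submatrix {l m : ℕ} (X : Mat l m) (σ : Equiv.Perm (Fin l)) :
    frobNorm (X.submatrix σ id) = frobNorm X :=
  congrArg Real.sqrt (Equiv.sum_comp σ fun i => ∑ j, X i j ^ 2)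

theorem frobNorm_sub_comm {l m : ℕ} (X Y : Mat l m) : frobNorm (X - Y) = frobNorm (Y - X) := by
  simp only [frobNorm, Matrix.sub_apply, sub_sq_comm]

theorem eq_zero_of_frobNorm_sq_eq_zero {l m : ℕ} {X : Mat l m} (h : frobNorm X ^ 2 = 0) :
    X = 0 := by
  rw [frobNorm_sq] at h
  ext i j
  have hi := (Finset.sum_eq_zero_iff_of_nonneg
    fun a _ => Finset.sum_nonneg fun b _ => sq_nonneg (X a b)).1 h i (Finset.mem_univ i)
  have hij := (Finset.sum_eq_zero_iff_of_nonneg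
    fun b _ => sq_nonneg (X i b)).1 hi j (Finset.mem_univ j)
  simpa using hij

theorem pdist_nonneg {l m : ℕ} (A B : Set (Mat l m)) : 0 ≤ pdist A B := by
  refine Real.sInf_nonneg ?_
  rintro _ ⟨X, -, Y, -, rfl⟩
  exact frobNorm_nonneg _

theorem pdist_le {l m : ℕ} {A B : Set (Mat l m)} {X Y : Mat l m} (hX : X ∈ A) (hY : Y ∈ B) :
    pdist A B ≤ frobNorm (X - Y) := by
  refine csInf_le ⟨0, ?_⟩ ⟨X, hX, Y, hY, rfl⟩
  rintro _ ⟨X, -, Y, -, rfl⟩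
  exact frobNorm_nonneg _

/-- The distance between two orbits is attained at any prescribed representation of the second. -/
theorem exists_pdist_orbit_eq {l m : ℕ} (X Z : Mat l m) :
    ∃ Y ∈ orbit X, pdist (orbit X) (orbit Z) = frobNorm (Y - Z) := by
  have hfin : {d | ∃ X' ∈ orbit X, ∃ Y ∈ orbit Z, d = frobNorm (X' - Y)}.Finite := by
    refine (Set.Finite.image2 (fun X' Y => frobNorm (X' - Y))
      (finite_orbit X) (finite_orbit Z)).subset ?_
    rintro _ ⟨X', hX', Y, hY, rfl⟩
    exact ⟨X', hX', Y, hY, rfl⟩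
  have hne : {d | ∃ X' ∈ orbit X, ∃ Y ∈ orbit Z, d = frobNorm (X' - Y)}.Nonempty :=
    ⟨_, X, self_mem_orbit X, Z, self_mem_orbit Z, rfl⟩
  obtain ⟨Y, hY, W, hW, h⟩ := hne.csInf_mem hfin
  obtain ⟨σ, rfl⟩ := mem_orbit_iff.1 hW
  refine ⟨Y.submatrix σ.symm id, submatrix_mem_orbit hY σ.symm, h.trans ?_⟩
  rw [← frobNorm_submatrix _ σ.symm]
  congr 1
  ext i j
  simp

theorem sum_sub_sq_eq {n : ℕ} (hn : 0 < n) (x : Fin n → ℝ) (z : ℝ) :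
    ∑ i, (x i - z) ^ 2 =
      ∑ i, (x i - (n : ℝ)⁻¹ * ∑ k, x k) ^ 2 + n * ((n : ℝ)⁻¹ * ∑ k, x k - z) ^ 2 := by
  have hn' : (n : ℝ) ≠ 0 := by positivity
  simp only [sub_sq, Finset.sum_add_distrib, Finset.sum_sub_distrib, ← Finset.sum_mul,
    ← Finset.mul_sum, Finset.sum_const, Finset.card_univ, Fintype.card_fin, nsmul_eq_mul]
  field_simp
  ring

/-- The parallel axis identity for the Frobenius norm. -/
theorem sum_frobNorm_sub_sq {l m n : ℕ} (hn : 0 < n) (R : Fin n → Mat l m) (Z : Mat l m) :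
    ∑ i, frobNorm (R i - Z) ^ 2 =
      ∑ i, frobNorm (R i - alignMean R) ^ 2 + n * frobNorm (alignMean R - Z) ^ 2 := by
  have hcomm : ∀ W : Mat l m, ∑ i, frobNorm (R i - W) ^ 2 =
      ∑ a, ∑ b, ∑ i, (R i a b - W a b) ^ 2 := by
    intro W
    simp only [frobNorm_sq, Matrix.sub_apply]
    rw [Finset.sum_comm]
    exact Finset.sum_congr rfl fun a _ => Finset.sum_comm
  rw [hcomm, hcomm, frobNorm_sq, Finset.mul_sum, ← Finset.sum_add_distrib]
  refine Finset.sum_congr rfl fun a _ => ?_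
  rw [Finset.mul_sum, ← Finset.sum_add_distrib]
  refine Finset.sum_congr rfl fun b _ => ?_
  simpa [alignMean, Matrix.sum_apply] using sum_sub_sq_eq hn (fun i => R i a b) (Z a b)

theorem alignCost_eq {l m n : ℕ} (hn : 0 < n) (R : Fin n → Mat l m) :
    alignCost R = 2 / n * ∑ i, frobNorm (R i - alignMean R) ^ 2 := by
  have hn' : (n : ℝ) ≠ 0 := by positivity
  have h : ∑ i, ∑ j, frobNorm (R i - R j) ^ 2 =
      2 * n * ∑ i, frobNorm (R i - alignMean R) ^ 2 := by
    rw [Finset.sum_comm]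
    simp only [sum_frobNorm_sub_sq hn R (R _), frobNorm_sub_comm (alignMean R),
      Finset.sum_add_distrib, ← Finset.mul_sum, Finset.sum_const, Finset.card_univ,
      Fintype.card_fin, nsmul_eq_mul]
    ring
  rw [alignCost, h]
  field_simp

theorem alignCost_le_iff {l m n : ℕ} (hn : 0 < n) (R R' : Fin n → Mat l m) :
    alignCost R ≤ alignCost R' ↔
      ∑ i, frobNorm (R i - alignMean R) ^ 2 ≤ ∑ i, frobNorm (R' i - alignMean R') ^ 2 := by
  rw [alignCost_eq hn, alignCost_eq hn]
  exact mul_le_mul_iff_right₀ (by positivity)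

theorem frechet_le_iff {l m n : ℕ} (hn : 0 < n) (s : Fin n → Set (Mat l m))
    (A B : Set (Mat l m)) :
    frechet s A ≤ frechet s B ↔ ∑ i, pdist (s i) A ^ 2 ≤ ∑ i, pdist (s i) B ^ 2 :=
  mul_le_mul_iff_right₀ (by positivity)

theorem sum_pdist_sq_le {l m n : ℕ} {s : Fin n → Set (Mat l m)} {R : Fin n → Mat l m}
    (hR : IsAlignment s R) (Z : Mat l m) :
    ∑ i, pdist (s i) (orbit Z) ^ 2 ≤ ∑ i, frobNorm (R i - Z) ^ 2 :=
  Finset.sum_le_sum fun i _ =>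
    pow_le_pow_left₀ (pdist_nonneg _ _) (pdist_le (hR i) (self_mem_orbit Z)) 2

theorem exists_alignment_sum_pdist_sq_eq {l m n : ℕ} {s : Fin n → Set (Mat l m)}
    (hs : ∀ i, s i ∈ PartitionSpace l m) (Z : Mat l m) :
    ∃ R, IsAlignment s R ∧
      ∑ i, pdist (s i) (orbit Z) ^ 2 = ∑ i, frobNorm (R i - Z) ^ 2 := by
  have h : ∀ i, ∃ Y ∈ s i, pdist (s i) (orbit Z) = frobNorm (Y - Z) := by
    intro i
    obtain ⟨X, -, hX⟩ := hs i
    rw [hX]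
    exact exists_pdist_orbit_eq X Z
  choose R hR hd using h
  exact ⟨R, hR, by simp only [hd]⟩

theorem isLabeled_alignMean {l m n : ℕ} (hn : 0 < n) {R : Fin n → Mat l m}
    (hR : ∀ i, IsLabeled (R i)) : IsLabeled (alignMean R) := by
  have hn' : (n : ℝ) ≠ 0 := by positivity
  have happ : ∀ a b, alignMean R a b = (n : ℝ)⁻¹ * ∑ i, R i a b := by
    intro a b
    simp [alignMean, Matrix.sum_apply]
  refine ⟨fun a b => ?_, fun b => ?_⟩
  · rw [happ]
    refine ⟨mul_nonneg (by positivity) (Finset.sum_nonneg fun i _ => ((hR i).1 a b).1), ?_⟩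
    rw [inv_mul_le_one₀ (by positivity)]
    simpa using Finset.sum_le_sum fun i (_ : i ∈ Finset.univ) => ((hR i).1 a b).2
  · simp only [happ]
    rw [← Finset.mul_sum, Finset.sum_comm]
    simp [(hR _).2 b, hn']

theorem orbit_alignMean_mem {l m n : ℕ} (hn : 0 < n) {s : Fin n → Set (Mat l m)}
    (hs : ∀ i, s i ∈ PartitionSpace l m) {R : Fin n → Mat l m} (hR : IsAlignment s R) :
    orbit (alignMean R) ∈ PartitionSpace l m := by
  refine ⟨alignMean R, isLabeled_alignMean hn fun i => ?_, rfl⟩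
  obtain ⟨X, hX, hi⟩ := hs i
  exact hX.of_mem_orbit (hi ▸ hR i)

/-- For any sample `𝒮ₙ` of `n ≥ 1` partitions, the map
`𝔛 ↦ π(M_𝔛)` restricts to a surjection from the optimal multiple alignments of
`𝒮ₙ` onto the mean partitions of `𝒮ₙ`: for every optimal multiple alignment
`𝔛`, the partition `π(M_𝔛)` is a mean partition of `𝒮ₙ`, and every mean
partition of `𝒮ₙ` arises this way. -/
theorem optimal_alignments_onto_mean_partitions (l m : ℕ) (hl : 1 ≤ l) (hm : 1 ≤ m)
    (n : ℕ) (hn : 0 < n)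
    (s : Fin n → Set (Mat l m)) (hs : ∀ i, s i ∈ PartitionSpace l m) :
    (∀ R : Fin n → Mat l m, IsOptimalAlignment s R →
      IsMeanPartition s (orbit (alignMean R))) ∧
    (∀ M : Set (Mat l m), IsMeanPartition s M →
      ∃ R : Fin n → Mat l m, IsOptimalAlignment s R ∧ orbit (alignMean R) = M) := by
  constructor
  · rintro R ⟨hR, hopt⟩
    refine ⟨orbit_alignMean_mem hn hs hR, ?_⟩
    rintro _ ⟨Z, -, rfl⟩
    obtain ⟨R', hR', hd⟩ := exists_alignment_sum_pdist_sq_eq hs Z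
    rw [frechet_le_iff hn, hd, sum_frobNorm_sub_sq hn R' Z]
    have h₁ := sum_pdist_sq_le hR (alignMean R)
    have h₂ := (alignCost_le_iff hn R R').1 (hopt R' hR')
    have h₃ : 0 ≤ n * frobNorm (alignMean R' - Z) ^ 2 := by positivity
    linarith
  · rintro _ ⟨⟨Z, -, rfl⟩, hmin⟩
    obtain ⟨R, hR, hd⟩ := exists_alignment_sum_pdist_sq_eq hs Z
    rw [sum_frobNorm_sub_sq hn R Z] at hd
    have hle : ∀ R', IsAlignment s R' →
        ∑ i, frobNorm (R i - alignMean R) ^ 2 + n * frobNorm (alignMean R - Z) ^ 2 ≤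
          ∑ i, frobNorm (R' i - alignMean R') ^ 2 := by
      intro R' hR'
      rw [← hd]
      exact ((frechet_le_iff hn s _ _).1 (hmin _ (orbit_alignMean_mem hn hs hR'))).trans
        (sum_pdist_sq_le hR' _)
    have hnonneg : 0 ≤ n * frobNorm (alignMean R - Z) ^ 2 := by positivity
    refine ⟨R, ⟨hR, fun R' hR' => (alignCost_le_iff hn R R').2 ?_⟩, ?_⟩
    · linarith [hle R' hR']
    · have hzero : n * frobNorm (alignMean R - Z) ^ 2 = 0 :=
        le_antisymm (by linarith [hle R hR]) hnonneg
      have hn' : (n : ℝ) ≠ 0 := by positivity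
      rw [sub_eq_zero.1 (eq_zero_of_frobNorm_sq_eq_zero ((mul_eq_zero.1 hzero).resolve_left hn'))]

end CJT
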